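/- arXiv:1505.00995 — 4 statements merged into one kernel-verified Lean document; each statement's English description precedes it below -/
import Mathlib

section
/- Let F : ℝ³ → ℝ be of class C² and let x₀ ∈ ℝ³ with ∇F(x₀) ≠ 0. On the open set where ∇F ≠ 0 define the unit normal field n = ∇F/‖∇F‖ and the tangential projector T = 𝟙 − n⊗n. Then at x₀, the tangential contraction of the gradient of anti(n) vanishes: for each i, Σ_{j,k} ∂_k (anti(n))_{ij} · T_{jk} = 0, i.e. ∇[anti(n)]:T = 0. -/
noncomputable section

open scoped BigOperators

/-- Vectors in ℝ³. -/
abbrev V3 : Type := Fin 3 → ℝ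

/-- 3×3 real matrices. -/
abbrev M3 : Type := Matrix (Fin 3) (Fin 3) ℝ

/-- The Levi-Civita symbol on `Fin 3`. -/
def eps (i j k : Fin 3) : ℝ :=
  if (i = 0 ∧ j = 1 ∧ k = 2) ∨ (i = 1 ∧ j = 2 ∧ k = 0) ∨ (i = 2 ∧ j = 0 ∧ k = 1) then 1
  else if (i = 0 ∧ j = 2 ∧ k = 1) ∨ (i = 2 ∧ j = 1 ∧ k = 0) ∨ (i = 1 ∧ j = 0 ∧ k = 2) then -1
  else 0

/-- Euclidean inner product on ℝ³. -/
def dot (a b : V3) : ℝ := ∑ i, a i * b i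

/-- Cross product on ℝ³: `(a × b)_i = Σ_{j,k} ε_{ijk} a_j b_k`. -/
def cross (a b : V3) : V3 := fun i => ∑ j, ∑ k, eps i j k * a j * b k

/-- Dyadic product `(a ⊗ b)_{ij} = a_i b_j`. -/
def tensor (a b : V3) : M3 := Matrix.of fun i j => a i * b j

/-- Symmetric part `sym X = (X + Xᵀ)/2`. -/
def symPart (X : M3) : M3 := (1 / 2 : ℝ) • (X + X.transpose)

/-- Skew-symmetric part `skw X = (X − Xᵀ)/2`. -/
def skwPart (X : M3) : M3 := (1 / 2 : ℝ) • (X - X.transpose)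

/-- Deviatoric part `dev X = X − (tr X / 3)·𝟙`. -/
def devPart (X : M3) : M3 := X - ((Matrix.trace X) / 3) • (1 : M3)

/-- Axial vector: `axl(X)_k = −(1/2) Σ_{i,j} ε_{ijk} X_{ij}`. -/
def axl (X : M3) : V3 := fun k => -(1 / 2 : ℝ) * ∑ i, ∑ j, eps i j k * X i j

/-- `anti(v)_{ij} = −Σ_k ε_{ijk} v_k`, so that `anti(v)·w = v × w`. -/
def antiV (v : V3) : M3 := Matrix.of fun i j => -(∑ k, eps i j k * v k)

/-- Squared Frobenius norm `‖X‖² = Σ_{ij} X_{ij}²`. -/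
def normSq (X : M3) : ℝ := ∑ i, ∑ j, (X i j) ^ 2

/-- `k`-th standard basis vector of ℝ³. -/
def ee (k : Fin 3) : V3 := Pi.single k 1

/-- Partial derivative `∂_k f` of a scalar field. -/
def pd (f : V3 → ℝ) (k : Fin 3) (x : V3) : ℝ := fderiv ℝ f x (ee k)

/-- Gradient of a scalar field. -/
def grad (f : V3 → ℝ) (x : V3) : V3 := fun k => pd f k x

/-- Partial derivative `∂_k u_i` of a vector field. -/
def pdV (u : V3 → V3) (i k : Fin 3) (x : V3) : ℝ := pd (fun y => u y i) k x

/-- Gradient matrix `(∇u)_{ij} = ∂_j u_i`. -/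
def gradV (u : V3 → V3) (x : V3) : M3 := Matrix.of fun i j => pdV u i j x

/-- Divergence `div u = Σ_p ∂_p u_p`. -/
def divV (u : V3 → V3) (x : V3) : ℝ := ∑ p, pdV u p p x

/-- Curl: `(curl u)_i = Σ_{j,k} ε_{ijk} ∂_j u_k`. -/
def curl (u : V3 → V3) (x : V3) : V3 := fun i => ∑ j, ∑ k, eps i j k * pdV u k j x

/-- Second partial derivative `∂_k ∂_j u_i` of a vector field. -/
def pd2V (u : V3 → V3) (i j k : Fin 3) (x : V3) : ℝ := pd (fun y => pdV u i j y) k x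

/-- Scalar Laplacian `Δf = Σ_m ∂_m ∂_m f`. -/
def lap (f : V3 → ℝ) (x : V3) : ℝ := ∑ m, pd (fun y => pd f m y) m x

/-- Unit normal field `n = ∇F/‖∇F‖` of the level surface of `F`. -/
def unitNormal (F : V3 → ℝ) (x : V3) : V3 :=
  fun i => grad F x i / Real.sqrt (dot (grad F x) (grad F x))

/-- Tangential projector `T = 𝟙 − n ⊗ n`. -/
def tangProj (F : V3 → ℝ) (x : V3) : M3 :=
  (1 : M3) - tensor (unitNormal F x) (unitNormal F x)

/-- The first partial derivatives of a `C²` function are differentiable. -/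
theorem differentiableAt_pd {F : V3 → ℝ} (hF : ContDiff ℝ 2 F) (l : Fin 3) (x : V3) :
    DifferentiableAt ℝ (fun y => pd F l y) x := by
  have h : Differentiable ℝ (fderiv ℝ F) :=
    (hF.fderiv_right (m := 1) (by norm_num)).differentiable (by norm_num)
  exact (h x).clm_apply (differentiableAt_const _)

/-- Symmetry of the Hessian of a `C²` function. -/
theorem pd_pd_comm {F : V3 → ℝ} (hF : ContDiff ℝ 2 F) (l k : Fin 3) (x : V3) :
    pd (fun y => pd F l y) k x = pd (fun y => pd F k y) l x := by
  have h : DifferentiableAt ℝ (fderiv ℝ F) x :=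
    (hF.fderiv_right (m := 1) (by norm_num)).differentiable (by norm_num) x
  have key : ∀ a b : Fin 3,
      pd (fun y => pd F a y) b x = fderiv ℝ (fderiv ℝ F) x (ee b) (ee a) := by
    intro a b
    simp only [pd]
    rw [fderiv_clm_apply h (differentiableAt_const _)]
    simp
  rw [key, key]
  exact (hF.contDiffAt.isSymmSndFDerivAt (by simp)).eq _ _

/-- The squared Euclidean norm of a nonzero vector is positive. -/
theorem dot_self_pos {v : V3} (hv : v ≠ 0) : 0 < dot v v := by
  obtain ⟨i, hi⟩ := Function.ne_iff.mp hv
  exact Finset.sum_pos' (fun j _ => mul_self_nonneg _) ⟨i, Finset.mem_univ i, mul_self_pos.mpr hi⟩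

/-- A component of the unit normal field is differentiable where the gradient does not vanish,
and its partial derivatives are `∂_k n_l = ‖∇F‖⁻¹ Σ_m T_{lm} ∂_k ∂_m F`. -/
theorem differentiableAt_unitNormal_and_pd {F : V3 → ℝ} {x : V3} (hF : ContDiff ℝ 2 F)
    (hx : grad F x ≠ 0) (l : Fin 3) :
    DifferentiableAt ℝ (fun y => unitNormal F y l) x ∧
      ∀ k, pd (fun y => unitNormal F y l) k x =
        (Real.sqrt (dot (grad F x) (grad F x)))⁻¹ *
          ∑ m, tangProj F x l m * pd (fun y => pd F m y) k x := by
  have hpos := dot_self_pos hx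
  have hr := Real.sqrt_pos.mpr hpos
  have hd : ∀ m, HasFDerivAt (fun y => pd F m y) (fderiv ℝ (fun y => pd F m y) x) x :=
    fun m => (differentiableAt_pd hF m x).hasFDerivAt
  have hdot : HasFDerivAt (fun y => dot (grad F y) (grad F y)) _ x :=
    HasFDerivAt.fun_sum (u := Finset.univ) fun m _ => (hd m).mul (hd m)
  have hn : HasFDerivAt (fun y => unitNormal F y l) _ x :=
    (hd l).mul ((hasDerivAt_inv hr.ne').comp_hasFDerivAt x (hdot.sqrt hpos.ne'))
  refine ⟨hn.differentiableAt, fun k => ?_⟩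
  conv_lhs => rw [pd, hn.fderiv]
  have hsum : ∑ m, tangProj F x l m * pd (fun y => pd F m y) k x =
      pd (fun y => pd F l y) k x -
        unitNormal F x l * ∑ m, unitNormal F x m * pd (fun y => pd F m y) k x := by
    simp [tangProj, tensor, Matrix.one_apply, sub_mul, Finset.sum_sub_distrib, Finset.mul_sum,
      mul_assoc]
  rw [hsum]
  simp only [unitNormal, grad, Fin.sum_univ_three] at hr ⊢
  set r := Real.sqrt (dot (fun k => pd F k x) fun k => pd F k x)
  have hr' := hr.ne'
  simp only [add_apply, smul_apply, smul_eq_mul]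
  simp only [← pd.eq_def]
  field_simp
  ring

/-- Contracting the Levi-Civita symbol with a symmetric array gives zero. -/
theorem sum_eps_mul_eq_zero {S : Fin 3 → Fin 3 → ℝ} (hS : ∀ a b, S a b = S b a) (i : Fin 3) :
    ∑ j, ∑ l, eps i j l * S l j = 0 := by
  have h01 := hS 0 1
  have h02 := hS 0 2
  have h12 := hS 1 2
  fin_cases i <;> simp [Fin.sum_univ_three, eps, h01, h02, h12]

/-- The tangential contraction of the gradient of `anti(n)` vanishes: `∇[anti(n)]:T = 0`. -/
theorem statement2 (F : V3 → ℝ) (x₀ : V3)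
    (hF : ContDiff ℝ 2 F) (hgrad : grad F x₀ ≠ 0) :
    ∀ i : Fin 3,
      ∑ j, ∑ k, pd (fun y => antiV (unitNormal F y) i j) k x₀ * tangProj F x₀ j k = 0 := by
  intro i
  have hT : ∀ a b, tangProj F x₀ a b = tangProj F x₀ b a := by
    intro a b
    simp [tangProj, tensor, Matrix.one_apply, eq_comm, mul_comm]
  have hanti : ∀ j k, pd (fun y => antiV (unitNormal F y) i j) k x₀ =
      -∑ l, eps i j l * pd (fun y => unitNormal F y l) k x₀ := by
    intro j k
    have h : HasFDerivAt (fun y => antiV (unitNormal F y) i j) _ x₀ :=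
      (HasFDerivAt.fun_sum (u := Finset.univ) fun l _ =>
        ((differentiableAt_unitNormal_and_pd hF hgrad l).1.hasFDerivAt.const_mul (eps i j l))).neg
    rw [pd, h.fderiv]
    simp [pd]
  set S : Fin 3 → Fin 3 → ℝ := fun l j =>
    ∑ k, pd (fun y => unitNormal F y l) k x₀ * tangProj F x₀ j k with hSdef
  have hS : ∀ a b, S a b = S b a := by
    intro a b
    simp only [hSdef, (differentiableAt_unitNormal_and_pd hF hgrad _).2, Finset.mul_sum,
      Finset.sum_mul]
    rw [Finset.sum_comm]
    refine Finset.sum_congr rfl fun m _ => Finset.sum_congr rfl fun k _ => ?_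
    rw [pd_pd_comm hF]
    ring
  calc ∑ j, ∑ k, pd (fun y => antiV (unitNormal F y) i j) k x₀ * tangProj F x₀ j k
      = -∑ j, ∑ l, eps i j l * S l j := by
        simp only [hanti, hSdef, Finset.mul_sum, Finset.sum_mul, neg_mul, Finset.sum_neg_distrib,
          mul_assoc]
        congr 1
        exact Finset.sum_congr rfl fun j _ => Finset.sum_comm
    _ = 0 := by rw [sum_eps_mul_eq_zero hS, neg_zero]
end
end

section
/- Let u : ℝ³ → ℝ³ be of class C³ and let α₁, α₂ ∈ ℝ. Define the third-order hyperstress tensor field 𝔪 by 𝔪_{ijk} = (α₁/2)(∂_k∂_j u_i − ∂_k∂_i u_j) + ((α₁−α₂)/4)(δ_{jk} ∂_i(div u) − δ_{jk} Δu_i + δ_{ik} Δu_j − δ_{ik} ∂_j(div u)). Then its divergence satisfies, for all i, j and all points of ℝ³: Σ_k ∂_k 𝔪_{ijk} = ((α₁+α₂)/4)·Δ(∂_j u_i − ∂_i u_j); equivalently, Div 𝔪 = ((α₁+α₂)/2)·Δ(skw ∇u). -/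
noncomputable section

open scoped BigOperators

/-- The third order hyperstress tensor of the indeterminate couple stress model:
`𝔪_{ijk} = (α₁/2)(∂_k∂_j u_i − ∂_k∂_i u_j)
  + ((α₁−α₂)/4)(δ_{jk} ∂_i(div u) − δ_{jk} Δu_i + δ_{ik} Δu_j − δ_{ik} ∂_j(div u))`. -/
def hyper (α₁ α₂ : ℝ) (u : V3 → V3) (i j k : Fin 3) (x : V3) : ℝ :=
  (α₁ / 2) * (pd2V u i j k x - pd2V u j i k x)
  + ((α₁ - α₂) / 4) *
      ((if j = k then (1 : ℝ) else 0) * pd (fun y => divV u y) i x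
        - (if j = k then (1 : ℝ) else 0) * lap (fun y => u y i) x
        + (if i = k then (1 : ℝ) else 0) * lap (fun y => u y j) x
        - (if i = k then (1 : ℝ) else 0) * pd (fun y => divV u y) j x)

theorem pd_add {f g : V3 → ℝ} (hf : Differentiable ℝ f) (hg : Differentiable ℝ g) (k : Fin 3)
    (x : V3) : pd (fun y => f y + g y) k x = pd f k x + pd g k x := by
  simp [pd, fderiv_fun_add (hf x) (hg x)]

theorem pd_sub {f g : V3 → ℝ} (hf : Differentiable ℝ f) (hg : Differentiable ℝ g) (k : Fin 3)
    (x : V3) : pd (fun y => f y - g y) k x = pd f k x - pd g k x := by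
  simp [pd, fderiv_fun_sub (hf x) (hg x)]

theorem pd_const_mul {f : V3 → ℝ} (hf : Differentiable ℝ f) (c : ℝ) (k : Fin 3) (x : V3) :
    pd (fun y => c * f y) k x = c * pd f k x := by
  simp [pd, fderiv_const_mul (hf x)]

theorem pd_sum {ι : Type*} {s : Finset ι} {f : ι → V3 → ℝ} (hf : ∀ m, Differentiable ℝ (f m))
    (k : Fin 3) (x : V3) : pd (fun y => ∑ m ∈ s, f m y) k x = ∑ m ∈ s, pd (f m) k x := by
  simp [pd, fderiv_fun_sum fun m _ => hf m x]

theorem ContDiff.pd {f : V3 → ℝ} {m n : WithTop ℕ∞} (hf : ContDiff ℝ n f) (hmn : m + 1 ≤ n)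
    (k : Fin 3) : ContDiff ℝ m (pd f k) :=
  (hf.fderiv_right hmn).clm_apply contDiff_const

theorem pd_comm {f : V3 → ℝ} (hf : ContDiff ℝ 2 f) (a b : Fin 3) :
    pd (pd f a) b = pd (pd f b) a := by
  funext x
  have hd : DifferentiableAt ℝ (fderiv ℝ f) x :=
    (hf.fderiv_right (m := 1) (by norm_num)).differentiable (by norm_num) x
  have h (c d : Fin 3) : pd (pd f c) d x = fderiv ℝ (fderiv ℝ f) x (ee d) (ee c) := by
    change fderiv ℝ (fun y => fderiv ℝ f y (ee c)) x (ee d) = _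
    simp [fderiv_clm_apply hd (differentiableAt_const _)]
  rw [h, h]
  exact (hf.contDiffAt.isSymmSndFDerivAt (by simp)).eq _ _

theorem pd_lap {f : V3 → ℝ} (hf : ContDiff ℝ 3 f) (j : Fin 3) (x : V3) :
    pd (lap f) j x = lap (pd f j) x := by
  have h2 (a : Fin 3) : ContDiff ℝ 2 (pd f a) := hf.pd (by norm_num) a
  have h1 (a b : Fin 3) : ContDiff ℝ 1 (pd (pd f a) b) := (h2 a).pd (by norm_num) b
  change pd (fun y => ∑ m, pd (pd f m) m y) j x = ∑ m, pd (pd (pd f j) m) m x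
  rw [pd_sum fun m => (h1 m m).differentiable (by norm_num)]
  refine Finset.sum_congr rfl fun m _ => ?_
  rw [pd_comm (h2 m), pd_comm (hf.of_le (by norm_num)) m j]

theorem lap_sub {f g : V3 → ℝ} (hf : ContDiff ℝ 2 f) (hg : ContDiff ℝ 2 g) (x : V3) :
    lap (fun y => f y - g y) x = lap f x - lap g x := by
  have d1 {h : V3 → ℝ} (hh : ContDiff ℝ 2 h) : Differentiable ℝ h :=
    hh.differentiable (by norm_num)
  have d2 {h : V3 → ℝ} (hh : ContDiff ℝ 2 h) (a : Fin 3) : Differentiable ℝ (pd h a) :=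
    (hh.pd (m := 1) (by norm_num) a).differentiable (by norm_num)
  simp only [lap, ← Finset.sum_sub_distrib]
  refine Finset.sum_congr rfl fun m _ => ?_
  simp only [pd_sub (d1 hf) (d1 hg)]
  exact pd_sub (d2 hf m) (d2 hg m) m x

/-- `Σ_k ∂_k 𝔪_{ijk} = ((α₁+α₂)/4)·Δ(∂_j u_i − ∂_i u_j)`. -/
theorem statement3 (α₁ α₂ : ℝ) (u : V3 → V3) (hu : ContDiff ℝ 3 u) :
    ∀ (i j : Fin 3) (x : V3),
      (∑ k, pd (fun y => hyper α₁ α₂ u i j k y) k x)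
        = ((α₁ + α₂) / 4) * lap (fun y => pdV u i j y - pdV u j i y) x := by
  intro i j x
  have hc (a : Fin 3) : ContDiff ℝ 3 (fun y => u y a) := contDiff_pi.mp hu a
  have h2 (a b : Fin 3) : ContDiff ℝ 2 (pdV u a b) := (hc a).pd (by norm_num) b
  have h1 (a b c : Fin 3) : ContDiff ℝ 1 (pd2V u a b c) := (h2 a b).pd (by norm_num) c
  have hdiv : ContDiff ℝ 2 (divV u) := ContDiff.sum fun p _ => h2 p p
  have dd2 (a b c : Fin 3) : Differentiable ℝ (pd2V u a b c) :=
    (h1 a b c).differentiable (by norm_num)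
  have ddiv (a : Fin 3) : Differentiable ℝ (pd (divV u) a) :=
    (hdiv.pd (m := 1) (by norm_num) a).differentiable (by norm_num)
  have dlap (a : Fin 3) : Differentiable ℝ (lap fun y => u y a) :=
    Differentiable.fun_sum fun m _ => dd2 a m m
  have key (k : Fin 3) : pd (fun y => hyper α₁ α₂ u i j k y) k x
      = α₁ / 2 * (pd (pd2V u i j k) k x - pd (pd2V u j i k) k x)
        + (α₁ - α₂) / 4 *
          ((if j = k then (1 : ℝ) else 0) * pd (pd (divV u) i) k x
            - (if j = k then (1 : ℝ) else 0) * pd (lap fun y => u y i) k x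
            + (if i = k then (1 : ℝ) else 0) * pd (lap fun y => u y j) k x
            - (if i = k then (1 : ℝ) else 0) * pd (pd (divV u) j) k x) := by
    unfold hyper
    have dA := (ddiv i).const_mul (if j = k then (1 : ℝ) else 0)
    have dB := (dlap i).const_mul (if j = k then (1 : ℝ) else 0)
    have dC := (dlap j).const_mul (if i = k then (1 : ℝ) else 0)
    have dD := (ddiv j).const_mul (if i = k then (1 : ℝ) else 0)
    have dM := (dd2 i j k).fun_sub (dd2 j i k)
    have dAB := dA.fun_sub dB
    have dABC := dAB.fun_add dC
    have dN := dABC.fun_sub dD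
    rw [pd_add (dM.const_mul _) (dN.const_mul _), pd_const_mul dM, pd_const_mul dN,
      pd_sub (dd2 i j k) (dd2 j i k), pd_sub dABC dD, pd_add dAB dC, pd_sub dA dB,
      pd_const_mul (ddiv i), pd_const_mul (dlap i), pd_const_mul (dlap j), pd_const_mul (ddiv j)]
  have hL (a b : Fin 3) : ∑ k, pd (pd2V u a b k) k x = lap (pdV u a b) x := rfl
  simp only [key, lap_sub (h2 i j) (h2 j i), Finset.sum_add_distrib, Finset.sum_sub_distrib,
    ← Finset.mul_sum, hL, ite_mul, one_mul, zero_mul, Finset.sum_ite_eq, Finset.mem_univ, if_true,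
    pd_lap (hc _), pd_comm hdiv i j]
  change _ + _ * (_ - lap (pdV u i j) x + lap (pdV u j i) x - _) = _
  ring
end
end

section
/- Let u : ℝ³ → ℝ³ be of class C² and let α₁, α₂ ∈ ℝ. Define S = sym ∇curl u and A = skw ∇curl u, i.e. S_{pq} = (1/2)(Σ_{r,s} ε_{prs} ∂_q∂_r u_s + Σ_{r,s} ε_{qrs} ∂_p∂_r u_s) and A_{pq} = (1/2)(Σ_{r,s} ε_{prs} ∂_q∂_r u_s − Σ_{r,s} ε_{qrs} ∂_p∂_r u_s). Then for all indices i, j, k and all points of ℝ³: (α₁/2)·Σ_p ε_{pji} S_{pk} + (α₂/2)·Σ_p ε_{pji} A_{pk} = (α₁/2)(∂_k∂_j u_i − ∂_k∂_i u_j) + ((α₁−α₂)/4)(δ_{jk} ∂_i(div u) − δ_{jk} Δu_i + δ_{ik} Δu_j − δ_{ik} ∂_j(div u)). (This is the explicit computation of the third-order hyperstress tensor of the indeterminate couple stress model from the symmetric and skew-symmetric parts of ∇curl u.) -/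
noncomputable section

open scoped BigOperators

/-- `S_{pq} = (sym ∇curl u)_{pq} = (1/2)(Σ_{r,s} ε_{prs} ∂_q∂_r u_s + Σ_{r,s} ε_{qrs} ∂_p∂_r u_s)`. -/
def Ssym (u : V3 → V3) (p q : Fin 3) (x : V3) : ℝ :=
  (1 / 2 : ℝ) * ((∑ r, ∑ s, eps p r s * pd2V u s r q x) + (∑ r, ∑ s, eps q r s * pd2V u s r p x))

/-- `A_{pq} = (skw ∇curl u)_{pq} = (1/2)(Σ_{r,s} ε_{prs} ∂_q∂_r u_s − Σ_{r,s} ε_{qrs} ∂_p∂_r u_s)`. -/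
def Askw (u : V3 → V3) (p q : Fin 3) (x : V3) : ℝ :=
  (1 / 2 : ℝ) * ((∑ r, ∑ s, eps p r s * pd2V u s r q x) - (∑ r, ∑ s, eps q r s * pd2V u s r p x))

/-- Second partial derivatives of a C² vector field commute. -/
theorem pd2V_comm {u : V3 → V3} (hu : ContDiff ℝ 2 u) (i j k : Fin 3) (x : V3) :
    pd2V u i j k x = pd2V u i k j x := by
  have hi : ContDiff ℝ 2 (fun y => u y i) := contDiff_pi.mp hu i
  have hd : DifferentiableAt ℝ (fderiv ℝ (fun y => u y i)) x :=
    ((hi.fderiv_right (m := 1) (by norm_num)).differentiable (by norm_num)) x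
  have key : ∀ a b : Fin 3, pd2V u i a b x
      = fderiv ℝ (fderiv ℝ (fun y => u y i)) x (ee b) (ee a) := by
    intro a b
    unfold pd2V pdV pd
    rw [fderiv_clm_apply hd (differentiableAt_const _)]
    simp
  rw [key, key]
  exact (hi.contDiffAt.isSymmSndFDerivAt (by simp)) _ _

/-- First partial derivatives of a C² vector field are differentiable. -/
theorem differentiable_pdV {u : V3 → V3} (hu : ContDiff ℝ 2 u) (i k : Fin 3) :
    Differentiable ℝ (fun y => pdV u i k y) := by
  have hi : ContDiff ℝ 2 (fun y => u y i) := contDiff_pi.mp hu i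
  have hd : Differentiable ℝ (fderiv ℝ (fun y => u y i)) :=
    (hi.fderiv_right (m := 1) (by norm_num)).differentiable (by norm_num)
  exact hd.clm_apply (differentiable_const _)

theorem pd_divV {u : V3 → V3} (hu : ContDiff ℝ 2 u) (i : Fin 3) (x : V3) :
    pd (fun y => divV u y) i x = ∑ p, pd2V u p p i x := by
  unfold pd2V
  simp only [pd, divV]
  rw [fderiv_fun_sum fun p _ => differentiable_pdV hu p p x]
  simp

theorem lap_component (u : V3 → V3) (i : Fin 3) (x : V3) :
    lap (fun y => u y i) x = ∑ m, pd2V u i m m x := rfl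

/-- Explicit computation of the third order hyperstress tensor from `S` and `A`:
`(α₁/2)·Σ_p ε_{pji} S_{pk} + (α₂/2)·Σ_p ε_{pji} A_{pk} = 𝔪_{ijk}`. -/
theorem statement6 (α₁ α₂ : ℝ) (u : V3 → V3) (hu : ContDiff ℝ 2 u) :
    ∀ (i j k : Fin 3) (x : V3),
      (α₁ / 2) * (∑ p, eps p j i * Ssym u p k x) + (α₂ / 2) * (∑ p, eps p j i * Askw u p k x)
        = (α₁ / 2) * (pd2V u i j k x - pd2V u j i k x)
          + ((α₁ - α₂) / 4) *
              ((if j = k then (1 : ℝ) else 0) * pd (fun y => divV u y) i x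
                - (if j = k then (1 : ℝ) else 0) * lap (fun y => u y i) x
                + (if i = k then (1 : ℝ) else 0) * lap (fun y => u y j) x
                - (if i = k then (1 : ℝ) else 0) * pd (fun y => divV u y) j x) := by
  intro i j k x
  rw [pd_divV hu, pd_divV hu, lap_component, lap_component]
  have h01 := fun s => pd2V_comm hu s 1 0 x
  have h02 := fun s => pd2V_comm hu s 2 0 x
  have h12 := fun s => pd2V_comm hu s 2 1 x
  simp only [Ssym, Askw, Fin.sum_univ_three]
  fin_cases i <;> fin_cases j <;> fin_cases k <;>
    simp [eps, h01, h02, h12, -mul_eq_mul_left_iff, -mul_eq_zero, -zero_eq_mul] <;> ring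
end
end

section
/- Let F : ℝ³ → ℝ be of class C², let ψ : ℝ³ → ℝ be of class C¹, and let x₀ ∈ ℝ³ with ∇F(x₀) ≠ 0. On the open set where ∇F ≠ 0 define n = ∇F/‖∇F‖ and T = 𝟙 − n⊗n. Then at x₀: ∇[ψ·anti(n)·T]:T = n × ∇ψ, i.e. for each i, Σ_{j,k} ∂_k (ψ·anti(n)·T)_{ij} · T_{jk} = (n × ∇ψ)_i. -/
noncomputable section

open scoped BigOperators

theorem antiV_mul_tangProj (F : V3 → ℝ) (y : V3) :
    antiV (unitNormal F y) * tangProj F y = antiV (unitNormal F y) := by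
  ext i j
  fin_cases i <;> fin_cases j <;>
    simp [Matrix.mul_apply, antiV, tangProj, tensor, Fin.sum_univ_three, eps, Matrix.one_apply] <;>
    ring

theorem differentiable_grad {F : V3 → ℝ} (hF : ContDiff ℝ 2 F) (k : Fin 3) :
    Differentiable ℝ (fun y => grad F y k) := by
  have h : ContDiff ℝ 1 (fderiv ℝ F) := hF.fderiv_right (by norm_num)
  exact (h.differentiable (by norm_num)).clm_apply (differentiable_const _)

/-- The Hessian of a `C²` function is symmetric. -/
theorem pd_grad_comm {F : V3 → ℝ} (hF : ContDiff ℝ 2 F) (x : V3) (j k : Fin 3) :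
    pd (fun y => grad F y j) k x = pd (fun y => grad F y k) j x := by
  have h : ContDiff ℝ 1 (fderiv ℝ F) := hF.fderiv_right (by norm_num)
  have hd : DifferentiableAt ℝ (fderiv ℝ F) x := h.differentiable (by norm_num) x
  have hpd (a b : Fin 3) :
      pd (fun y => grad F y a) b x = fderiv ℝ (fderiv ℝ F) x (ee b) (ee a) := by
    simp only [pd, grad]
    rw [fderiv_clm_apply hd (differentiableAt_const _)]
    simp
  rw [hpd, hpd]
  exact (hF.contDiffAt.isSymmSndFDerivAt (by simp)) _ _

theorem hasFDerivAt_unitNormal {F : V3 → ℝ} (hF : ContDiff ℝ 2 F) {x : V3}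
    (hx : grad F x ≠ 0) (l : Fin 3) :
    HasFDerivAt (fun y => unitNormal F y l)
      ((Real.sqrt (dot (grad F x) (grad F x)))⁻¹ •
        (fderiv ℝ (fun y => grad F y l) x -
          unitNormal F x l • ∑ m, unitNormal F x m • fderiv ℝ (fun y => grad F y m) x)) x := by
  have hpos := dot_self_pos hx
  have hp (m : Fin 3) := (differentiable_grad hF m x).hasFDerivAt
  have hq : HasFDerivAt (fun y => dot (grad F y) (grad F y))
      (∑ m, (grad F x m • fderiv ℝ (fun y => grad F y m) x +
        grad F x m • fderiv ℝ (fun y => grad F y m) x)) x :=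
    HasFDerivAt.fun_sum fun m _ => (hp m).mul (hp m)
  have hs : Real.sqrt (dot (grad F x) (grad F x)) ≠ 0 := (Real.sqrt_pos.mpr hpos).ne'
  have h := (hp l).mul
    ((hasDerivAt_inv hs).comp_hasFDerivAt x (hq.sqrt hpos.ne'))
  refine (h.congr_fderiv ?_).congr_of_eventuallyEq (.of_forall fun y => ?_)
  · ext v
    simp [unitNormal, Fin.sum_univ_three]
    field_simp
    ring
  · simp [unitNormal, div_eq_mul_inv]

theorem pd_unitNormal {F : V3 → ℝ} (hF : ContDiff ℝ 2 F) {x : V3}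
    (hx : grad F x ≠ 0) (l k : Fin 3) :
    pd (fun y => unitNormal F y l) k x =
      (Real.sqrt (dot (grad F x) (grad F x)))⁻¹ *
        (pd (fun y => grad F y l) k x -
          unitNormal F x l * ∑ m, unitNormal F x m * pd (fun y => grad F y m) k x) := by
  rw [pd, (hasFDerivAt_unitNormal hF hx l).fderiv]
  simp [pd, Finset.mul_sum]

theorem pd_smul_antiV {ψ : V3 → ℝ} {u : V3 → V3} {x : V3} (hψ : DifferentiableAt ℝ ψ x)
    (hu : ∀ l, DifferentiableAt ℝ (fun y => u y l) x) (i j k : Fin 3) :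
    pd (fun y => (ψ y • antiV (u y)) i j) k x =
      grad ψ x k * antiV (u x) i j - ψ x * ∑ l, eps i j l * pd (fun y => u y l) k x := by
  have h := hψ.hasFDerivAt.mul (HasFDerivAt.fun_sum (u := Finset.univ)
    fun l _ => (hu l).hasFDerivAt.const_mul (eps i j l)).neg
  have h' : HasFDerivAt (fun y => (ψ y • antiV (u y)) i j) _ x :=
    h.congr_of_eventuallyEq (.of_forall fun y => by simp [antiV])
  rw [pd, h'.fderiv]
  simp [pd, grad, antiV, Fin.sum_univ_three]
  ring

/-- `∇[ψ·anti(n)·T]:T = n × ∇ψ` at a point where `∇F ≠ 0`. -/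
theorem statement15 (F : V3 → ℝ) (ψ : V3 → ℝ) (x₀ : V3)
    (hF : ContDiff ℝ 2 F) (hψ : ContDiff ℝ 1 ψ) (hgrad : grad F x₀ ≠ 0) :
    ∀ i : Fin 3,
      ∑ j, ∑ k,
          pd (fun y => (ψ y • (antiV (unitNormal F y) * tangProj F y)) i j) k x₀ *
            tangProj F x₀ j k
        = cross (unitNormal F x₀) (grad ψ x₀) i := by
  intro i
  simp only [antiV_mul_tangProj]
  simp only [pd_smul_antiV (hψ.differentiable (by norm_num) x₀)
    fun l => (hasFDerivAt_unitNormal hF hgrad l).differentiableAt, pd_unitNormal hF hgrad]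
  have h01 := pd_grad_comm hF x₀ 0 1
  have h02 := pd_grad_comm hF x₀ 0 2
  have h12 := pd_grad_comm hF x₀ 1 2
  fin_cases i <;>
    simp [tangProj, tensor, antiV, cross, Fin.sum_univ_three, eps, Matrix.one_apply,
      h01, h02, h12] <;>
    ring
end
end
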